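/- arXiv:2303.18146 — 2 statements merged into one kernel-verified Lean document; each statement's English description precedes it below -/
import Mathlib

section
/- For j ∈ {1,…,p} and k ∈ {1,…,d}, let i_k(j) be the largest index i ∈ {1,…,q} with (b_i)_k = j, with i_k(j) := 0 if no such i exists. Then for every j ∈ {1,…,p}: F_{α,j} = F_{α,j−1} + χ_1(G_{b_{i_1(j)}}) + ⋯ + χ_d(G_{b_{i_d(j)}}). (This is the first formula of Proposition 5.4(a), evaluated at the base flag.) -/
open Submodule Matrix Module

noncomputable section

/-- The index `(k-1)m + r` (0-based: `k*m + r`) of the basis vector `χ_k(e_r)` in `ℂ^(d*m)`. -/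
def toIdx (m d : ℕ) (k : Fin d) (r : Fin m) : Fin (d * m) :=
  ⟨(k : ℕ) * m + (r : ℕ), by
    have h3 : (r : ℕ) < m := r.2
    calc (k : ℕ) * m + (r : ℕ) < (k : ℕ) * m + m := by omega
      _ = ((k : ℕ) + 1) * m := by ring
      _ ≤ d * m := Nat.mul_le_mul_right m k.2⟩

theorem m_pos_of {m d : ℕ} (i : Fin (d * m)) : 0 < m := by
  rcases Nat.eq_zero_or_pos m with h | h
  · subst h; exact absurd i.2 (by simp)
  · exact h

/-- The block-diagonal embedding `δ' : M_m(ℂ) → M_{dm}(ℂ)`, `X ↦ diag(X,…,X)`. -/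
def delta' (m d : ℕ) (X : Matrix (Fin m) (Fin m) ℂ) :
    Matrix (Fin (d * m)) (Fin (d * m)) ℂ := fun i j =>
  if (i : ℕ) / m = (j : ℕ) / m then
    X ⟨(i : ℕ) % m, Nat.mod_lt _ (m_pos_of i)⟩ ⟨(j : ℕ) % m, Nat.mod_lt _ (m_pos_of j)⟩
  else 0

/-- `Fsub m d p α t` is the span of the `e_i` with `α(i) ≤ t` (`α` written 0-based,
`t` written 1-based, so the condition is `(α i) + 1 ≤ t`);
this is `F_{α,t}`, with `F_{α,0} = 0` and `F_{α,p} = ℂ^n`. -/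
def Fsub (m d p : ℕ) (α : Fin (d * m) → Fin p) (t : ℕ) : Submodule ℂ (Fin (d * m) → ℂ) :=
  Submodule.span ℂ {v | ∃ i : Fin (d * m), (α i : ℕ) + 1 ≤ t ∧ v = Pi.single i (1 : ℂ)}

/-- `β(r) = (α(r), α(m+r), …, α((d−1)m+r))`. -/
def beta (m d p : ℕ) (α : Fin (d * m) → Fin p) (r : Fin m) : Fin d → Fin p :=
  fun k => α (toIdx m d k r)

/-- `G_b`, the span of the `e_r` with `β(r) ≤ b` (componentwise order). -/
def Gsub (m d p : ℕ) (α : Fin (d * m) → Fin p) (c : Fin d → Fin p) :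
    Submodule ℂ (Fin m → ℂ) :=
  Submodule.span ℂ {v | ∃ r : Fin m, beta m d p α r ≤ c ∧ v = Pi.single r (1 : ℂ)}

/-- The linear embedding `χ_k : ℂ^m → ℂ^(dm)` onto the `k`-th block of coordinates. -/
def chi (m d : ℕ) (k : Fin d) : (Fin m → ℂ) →ₗ[ℂ] (Fin (d * m) → ℂ) where
  toFun v i :=
    if (i : ℕ) / m = (k : ℕ) then v ⟨(i : ℕ) % m, Nat.mod_lt _ (m_pos_of i)⟩ else 0
  map_add' x y := by
    funext i
    by_cases h : (i : ℕ) / m = (k : ℕ) <;> simp [h]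
  map_smul' c x := by
    funext i
    by_cases h : (i : ℕ) / m = (k : ℕ) <;> simp [h]

/-- For `1 ≤ t ≤ q`, `Gext α b t = G_{b_t}` (`t` written 1-based); `Gext α b 0 = G_{b_0} = 0`. -/
def Gext (m d p : ℕ) (α : Fin (d * m) → Fin p) {q : ℕ} (b : Fin q → Fin d → Fin p)
    (t : ℕ) : Submodule ℂ (Fin m → ℂ) :=
  if h : 1 ≤ t ∧ t ≤ q then Gsub m d p α (b ⟨t - 1, by omega⟩) else ⊥

/-- `iP b k j = i′_k(j)`: the largest (1-based) index `i ∈ {1,…,q}` with `(b_i)_k ≤ j`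
(`j` written 1-based), and `0` if there is no such index. -/
def iP {d p q : ℕ} (b : Fin q → Fin d → Fin p) (k : Fin d) (j : ℕ) : ℕ :=
  (Finset.univ.filter fun i : Fin q => (b i k : ℕ) + 1 ≤ j).sup fun i => (i : ℕ) + 1

/-- `iN b k j = i_k(j)`: the largest (1-based) index `i ∈ {1,…,q}` with `(b_i)_k = j`
(`j` written 1-based), and `0` if there is no such index. -/
def iN {d p q : ℕ} (b : Fin q → Fin d → Fin p) (k : Fin d) (j : ℕ) : ℕ :=
  (Finset.univ.filter fun i : Fin q => (b i k : ℕ) + 1 = j).sup fun i => (i : ℕ) + 1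

/-- `Dval α b t = d_t = #{r : β(r) ≤ b_t}` for `1 ≤ t ≤ q`, and `d_0 = 0`. -/
def Dval (m d p : ℕ) (α : Fin (d * m) → Fin p) {q : ℕ} (b : Fin q → Fin d → Fin p)
    (t : ℕ) : ℕ :=
  if h : 1 ≤ t ∧ t ≤ q then
    (Finset.univ.filter fun r : Fin m =>
      ∀ k : Fin d, beta m d p α r k ≤ b ⟨t - 1, by omega⟩ k).card
  else 0

/-- `Vmap b F j = V_j = χ_1(F_{i′_1(j)}) + ⋯ + χ_d(F_{i′_d(j)})` for a (1-based) `ℕ`-indexed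
chain `F` of subspaces of `ℂ^m` (with the conventions `F 0 = 0`, `F q = ℂ^m` built into the
chain). -/
def Vmap (m : ℕ) {d p q : ℕ} (b : Fin q → Fin d → Fin p)
    (F : ℕ → Submodule ℂ (Fin m → ℂ)) (j : ℕ) : Submodule ℂ (Fin (d * m) → ℂ) :=
  ⨆ k : Fin d, Submodule.map (chi m d k) (F (iP b k j))

/-- A chain `0 = F_0 ⊆ F_1 ⊆ ⋯ ⊆ F_q = ℂ^m` with `dim F_i = d_i`, i.e. a point of the flag
variety `Fl(d_1,…,d_{q−1}; ℂ^m)` together with the conventions `F_0 = 0`, `F_q = ℂ^m`. -/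
def GoodChain (m d p : ℕ) (α : Fin (d * m) → Fin p) {q : ℕ} (b : Fin q → Fin d → Fin p)
    (F : ℕ → Submodule ℂ (Fin m → ℂ)) : Prop :=
  F 0 = ⊥ ∧ F q = ⊤ ∧ (∀ i : ℕ, i < q → F i ≤ F (i + 1)) ∧
    ∀ i : ℕ, i ≤ q → finrank ℂ (F i) = Dval m d p α b i

theorem chi_single_aux (m d : ℕ) (k : Fin d) (r : Fin m) :
    chi m d k (Pi.single r (1 : ℂ)) = Pi.single (toIdx m d k r) (1 : ℂ) := by
  have hm : 0 < m := lt_of_le_of_lt (Nat.zero_le _) r.2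
  funext i
  show (if (i : ℕ) / m = (k : ℕ) then (Pi.single r (1 : ℂ) : Fin m → ℂ)
    ⟨(i : ℕ) % m, Nat.mod_lt _ (m_pos_of i)⟩ else 0) = _
  have key : i = toIdx m d k r ↔ ((i : ℕ) / m = k ∧ (i : ℕ) % m = r) := by
    rw [Fin.ext_iff]
    show (i : ℕ) = (k : ℕ) * m + (r : ℕ) ↔ _
    constructor
    · intro h
      rw [h]
      refine ⟨?_, ?_⟩
      · rw [Nat.mul_comm, Nat.mul_add_div hm, Nat.div_eq_of_lt r.2, Nat.add_zero]
      · rw [Nat.mul_comm, Nat.mul_add_mod, Nat.mod_eq_of_lt r.2]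
    · rintro ⟨h1, h2⟩
      rw [← h1, ← h2]
      exact (Nat.div_add_mod' _ _).symm
  simp only [Pi.single_apply, key, Fin.ext_iff]
  split_ifs <;> simp_all

theorem exists_toIdx_aux (m d : ℕ) (i : Fin (d * m)) :
    ∃ (k : Fin d) (r : Fin m), toIdx m d k r = i := by
  have hm := m_pos_of i
  refine ⟨⟨(i : ℕ) / m, ?_⟩, ⟨(i : ℕ) % m, Nat.mod_lt _ hm⟩, ?_⟩
  · rw [Nat.div_lt_iff_lt_mul hm]; exact i.2
  · apply Fin.ext
    show (i : ℕ) / m * m + (i : ℕ) % m = i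
    rw [Nat.mul_comm]; exact Nat.div_add_mod _ _

/-- first formula of Proposition 5.4(a) at the base flag. For every
`j ∈ {1,…,p}`, `F_{α,j} = F_{α,j−1} + χ_1(G_{b_{i_1(j)}}) + ⋯ + χ_d(G_{b_{i_d(j)}})`. -/
theorem stmt7 (m d p : ℕ) (hm : 0 < m) (hd : 0 < d) (hp : 0 < p)
    (α : Fin (d * m) → Fin p) (hα : Function.Surjective α)
    {q : ℕ} (b : Fin q → Fin d → Fin p) (hb : StrictMono b)
    (hrange : Set.range b = Set.range (beta m d p α)) :
    ∀ j : ℕ, 1 ≤ j → j ≤ p →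
      Fsub m d p α j =
        Fsub m d p α (j - 1) ⊔
          ⨆ k : Fin d, Submodule.map (chi m d k) (Gext m d p α b (iN b k j)) := by
  intro j hj1 hjp
  apply le_antisymm
  · apply Submodule.span_le.2
    rintro v ⟨i, hi, rfl⟩
    by_cases h : (α i : ℕ) + 1 ≤ j - 1
    · exact Submodule.mem_sup_left (Submodule.subset_span ⟨i, h, rfl⟩)
    · apply Submodule.mem_sup_right
      obtain ⟨k, r, rfl⟩ := exists_toIdx_aux m d i
      have hr : beta m d p α r ∈ Set.range b := hrange ▸ ⟨r, rfl⟩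
      obtain ⟨s, hs⟩ := hr
      have hsk : (b s k : ℕ) + 1 = j := by
        rw [hs]
        show (α (toIdx m d k r) : ℕ) + 1 = j
        omega
      have h1 : (s : ℕ) + 1 ≤ iN b k j :=
        Finset.le_sup (f := fun i : Fin q => (i : ℕ) + 1)
          (Finset.mem_filter.2 ⟨Finset.mem_univ s, hsk⟩)
      have h2 : iN b k j ≤ q := Finset.sup_le fun i _ => i.2
      apply Submodule.mem_iSup_of_mem k
      refine ⟨Pi.single r 1, ?_, chi_single_aux m d k r⟩
      have h3 : 1 ≤ iN b k j ∧ iN b k j ≤ q := ⟨by omega, h2⟩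
      rw [Gext, dif_pos h3]
      refine Submodule.subset_span ⟨r, ?_, rfl⟩
      rw [← hs]
      apply hb.monotone
      rw [Fin.le_def]
      show (s : ℕ) ≤ iN b k j - 1
      omega
  · apply sup_le
    · apply Submodule.span_mono
      rintro v ⟨i, hi, rfl⟩
      exact ⟨i, by omega, rfl⟩
    · apply iSup_le
      intro k
      rw [Submodule.map_le_iff_le_comap, Gext]
      split_ifs with h
      · apply Submodule.span_le.2
        rintro v ⟨r, hr, rfl⟩
        show chi m d k (Pi.single r 1) ∈ Fsub m d p α j
        rw [chi_single_aux]
        refine Submodule.subset_span ⟨_, ?_, rfl⟩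
        have hne : (Finset.univ.filter fun i : Fin q => (b i k : ℕ) + 1 = j).Nonempty := by
          rw [Finset.nonempty_iff_ne_empty]
          intro he
          have := h.1
          rw [iN, he, Finset.sup_empty] at this
          exact absurd this (by simp)
        obtain ⟨s, hs, hse⟩ := Finset.exists_mem_eq_sup _ hne fun i : Fin q => (i : ℕ) + 1
        have hse' : iN b k j = (s : ℕ) + 1 := hse
        have hs2 : (b s k : ℕ) + 1 = j := (Finset.mem_filter.1 hs).2
        have hidx : (⟨iN b k j - 1, by omega⟩ : Fin q) = s := by
          apply Fin.ext
          show iN b k j - 1 = s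
          omega
        rw [hidx] at hr
        have h5 : (α (toIdx m d k r) : ℕ) ≤ b s k := hr k
        omega
      · exact bot_le
end
end

section
/- Assume q ≥ 2, and let φ : Fl(d_1,…,d_{q−1};ℂ^m) → Fl(t_1,…,t_{p−1};ℂ^n), where t_j := #{i ∈ {1,…,n} : α(i) ≤ j}, be the map sending a flag (F_1,…,F_{q−1}) (with the conventions F_0 = 0 and F_q = ℂ^m) to the flag (V_1,…,V_{p−1}) with V_j = χ_1(F_{i′_1(j)}) + ⋯ + χ_d(F_{i′_d(j)}). Then φ is a strict standard extension if and only if there exists c ∈ {1,…,d} such that (b_i)_k = (b_q)_k for every k ∈ {1,…,d} with k ≠ c and every i ∈ {1,…,q}. (This is Proposition 5.4(d) stated combinatorially: φ is a standard extension exactly when all ordinary edges of the associated E-graph have the same colour, in which case φ is a strict standard extension.) -/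
open Submodule Matrix Module

noncomputable section

theorem toIdx_div (m d : ℕ) (k : Fin d) (r : Fin m) : ((toIdx m d k r : Fin (d*m)) : ℕ) / m = k := by
  have hr := r.2
  have : 0 < m := by omega
  simp only [toIdx]
  rw [mul_comm, Nat.mul_add_div this, Nat.div_eq_of_lt hr, add_zero]

theorem toIdx_mod (m d : ℕ) (k : Fin d) (r : Fin m) : ((toIdx m d k r : Fin (d*m)) : ℕ) % m = r := by
  have hr := r.2
  simp only [toIdx]
  rw [mul_comm, Nat.mul_add_mod, Nat.mod_eq_of_lt hr]

/-- projection to the block `k` -/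
def prj (m d : ℕ) (k : Fin d) : (Fin (d * m) → ℂ) →ₗ[ℂ] (Fin m → ℂ) :=
  LinearMap.funLeft ℂ ℂ (toIdx m d k)

theorem prj_chi_same (m d : ℕ) (k : Fin d) (v : Fin m → ℂ) : prj m d k (chi m d k v) = v := by
  funext r
  have h1 := toIdx_div m d k r
  have h2 := toIdx_mod m d k r
  simp only [prj, LinearMap.funLeft_apply, chi, LinearMap.coe_mk, AddHom.coe_mk, h1, h2, if_true]

theorem prj_chi_ne (m d : ℕ) (k l : Fin d) (h : k ≠ l) (v : Fin m → ℂ) :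
    prj m d k (chi m d l v) = 0 := by
  funext r
  have h1 := toIdx_div m d k r
  have : ¬ ((k : ℕ) = l) := fun h' => h (Fin.ext h')
  simp only [prj, LinearMap.funLeft_apply, chi, LinearMap.coe_mk, AddHom.coe_mk, h1, this, if_false,
    Pi.zero_apply]

theorem prj_Vmap (m : ℕ) {d p q : ℕ} (b : Fin q → Fin d → Fin p)
    (F : ℕ → Submodule ℂ (Fin m → ℂ)) (j : ℕ) (k : Fin d) :
    (Vmap m b F j).map (prj m d k) = F (iP b k j) := by
  rw [Vmap, Submodule.map_iSup, iSup_split_single _ k]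
  apply le_antisymm
  · apply sup_le
    · rintro _ ⟨_, ⟨x, hx, rfl⟩, rfl⟩
      rw [prj_chi_same]; exact hx
    · refine iSup₂_le fun l hl => ?_
      rintro _ ⟨_, ⟨x, hx, rfl⟩, rfl⟩
      rw [prj_chi_ne _ _ _ _ hl.symm]; exact zero_mem _
  · refine le_trans ?_ le_sup_left
    intro x hx
    exact ⟨_, ⟨x, hx, rfl⟩, prj_chi_same _ _ _ _⟩

theorem iP_mono {d p q : ℕ} (b : Fin q → Fin d → Fin p) (k : Fin d) {j j' : ℕ} (h : j ≤ j') :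
    iP b k j ≤ iP b k j' := by
  unfold iP
  apply Finset.sup_mono
  intro i hi
  simp only [Finset.mem_filter, Finset.mem_univ, true_and] at hi ⊢
  omega

theorem iP_le {d p q : ℕ} (b : Fin q → Fin d → Fin p) (k : Fin d) (j : ℕ) :
    iP b k j ≤ q := by
  unfold iP
  apply Finset.sup_le
  intro i _
  exact i.2

theorem iP_const {d p q : ℕ} (hq : 0 < q) (b : Fin q → Fin d → Fin p) (k : Fin d) (j : ℕ)
    (x : Fin p) (h : ∀ i, b i k = x) : iP b k j = if (x : ℕ) + 1 ≤ j then q else 0 := by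
  unfold iP
  simp only [h]
  split_ifs with hx
  · apply le_antisymm
    · exact Finset.sup_le fun i _ => i.2
    · have := Finset.le_sup (f := fun i : Fin q => (i : ℕ) + 1)
        (s := Finset.univ.filter fun i : Fin q => (x : ℕ) + 1 ≤ j)
        (b := ⟨q - 1, by omega⟩) (by simp [hx])
      refine le_trans ?_ this
      simp only
      omega
  · simp [hx]

theorem exists_j {d p q : ℕ} (hq : 2 ≤ q) (b : Fin q → Fin d → Fin p) (hb : StrictMono b)
    (c : Fin d) (i : Fin q) (h : b i c ≠ b ⟨q - 1, by omega⟩ c) :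
    ∃ j, 1 ≤ j ∧ j ≤ p - 1 ∧ 1 ≤ iP b c j ∧ iP b c j < q := by
  have hle : b i c ≤ b ⟨q - 1, by omega⟩ c := hb.monotone (Fin.mk_le_mk.2 (by omega) : i ≤ ⟨q-1, _⟩) c
  have hlt : b i c < b ⟨q - 1, by omega⟩ c := lt_of_le_of_ne hle h
  have hlt' : (b i c : ℕ) < b ⟨q - 1, by omega⟩ c := hlt
  have := (b ⟨q - 1, by omega⟩ c).2
  refine ⟨(b i c : ℕ) + 1, by omega, by omega, ?_, ?_⟩
  · unfold iP
    refine le_trans ?_ (Finset.le_sup (b := i) (by simp))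
    omega
  · unfold iP
    rw [Finset.sup_lt_iff (by simp only [Nat.bot_eq_zero]; omega)]
    intro i' hi'
    simp only [Finset.mem_filter, Finset.mem_univ, true_and] at hi'
    by_contra hcon
    have : i' = ⟨q - 1, by omega⟩ := by apply Fin.ext; simp only; omega
    rw [this] at hi'
    omega

/-- coordinate subspace chain -/
def CC {m : ℕ} (f : Fin m → ℕ) (i : ℕ) : Submodule ℂ (Fin m → ℂ) :=
  ⨅ r ∈ ({r | ¬ f r < i} : Set (Fin m)), LinearMap.ker (LinearMap.proj r : (Fin m → ℂ) →ₗ[ℂ] ℂ)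

theorem mem_CC {m : ℕ} (f : Fin m → ℕ) (i : ℕ) (x : Fin m → ℂ) :
    x ∈ CC f i ↔ ∀ r, ¬ f r < i → x r = 0 := by
  simp [CC, Submodule.mem_iInf]

theorem single_mem_CC {m : ℕ} (f : Fin m → ℕ) (i : ℕ) (r : Fin m) :
    Pi.single r (1:ℂ) ∈ CC f i ↔ f r < i := by
  rw [mem_CC]
  constructor
  · intro h
    by_contra hc
    simpa using h r hc
  · intro h s hs
    have : s ≠ r := by rintro rfl; exact hs h
    simp [this]

theorem finrank_CC {m : ℕ} (f : Fin m → ℕ) (i : ℕ) :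
    finrank ℂ (CC f i) = (Finset.univ.filter fun r => f r < i).card := by
  classical
  have e := LinearMap.iInfKerProjEquiv ℂ (fun _ : Fin m => ℂ) (I := {r | f r < i})
    (J := {r | ¬ f r < i}) (by rw [Set.disjoint_left]; intro a h h'; exact h' h)
    (by intro a _; by_cases h : f a < i <;> simp [h]; omega)
  rw [CC, e.finrank_eq, Module.finrank_pi, Fintype.card_subtype]
  rfl

theorem good_CC {m d p : ℕ} {α : Fin (d * m) → Fin p} {q : ℕ} {b : Fin q → Fin d → Fin p}
    (hb : StrictMono b) (idx : Fin m → Fin q) (hidx : ∀ r, b (idx r) = beta m d p α r)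
    (σ : Equiv.Perm (Fin m)) : GoodChain m d p α b (CC (fun r => (idx (σ r) : ℕ))) := by
  refine ⟨?_, ?_, ?_, ?_⟩
  · rw [eq_bot_iff]; intro x hx; rw [mem_CC] at hx
    simp only [not_lt_zero, not_false_eq_true, true_imp_iff] at hx
    exact funext hx
  · rw [eq_top_iff]; intro x _; rw [mem_CC]
    intro r hr; exact absurd (idx (σ r)).2 hr
  · intro i _ x hx; rw [mem_CC] at hx ⊢
    intro r hr; exact hx r (by omega)
  · intro i hi
    rw [finrank_CC, Dval]
    split_ifs with h
    · apply Finset.card_bij (fun r _ => σ r)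
      · intro r hr
        simp only [Finset.mem_filter, Finset.mem_univ, true_and] at hr ⊢
        rw [← hidx]
        exact hb.monotone (Fin.mk_le_mk.2 (by omega) : idx (σ r) ≤ ⟨i-1, _⟩)
      · intro r _ s _ h; exact σ.injective h
      · intro r hr
        simp only [Finset.mem_filter, Finset.mem_univ, true_and] at hr
        refine ⟨σ.symm r, ?_, by simp⟩
        simp only [Finset.mem_filter, Finset.mem_univ, true_and, Equiv.apply_symm_apply]
        rw [← hidx] at hr
        have := hb.le_iff_le.1 (show b (idx r) ≤ b ⟨i-1, _⟩ from hr)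
        have : (idx r : ℕ) ≤ i - 1 := this
        omega
    · have : i = 0 := by omega
      subst this
      simp

theorem key {m d p : ℕ} {α : Fin (d * m) → Fin p} {q : ℕ} {b : Fin q → Fin d → Fin p}
    (hb : StrictMono b) (hrange : Set.range b = Set.range (beta m d p α)) (hq : 2 ≤ q)
    (E : (Fin m → ℂ) →ₗ[ℂ] (Fin (d * m) → ℂ))
    (Zc : ℕ → Submodule ℂ (Fin (d * m) → ℂ)) (κ : ℕ → ℕ)
    (H : ∀ F : ℕ → Submodule ℂ (Fin m → ℂ), GoodChain m d p α b F →
          ∀ j : ℕ, 1 ≤ j → j ≤ p - 1 → Vmap m b F j = Submodule.map E (F (κ j)) ⊔ Zc j)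
    (c c' : Fin d) (hcc : c ≠ c') (j j' : ℕ) (hj1 : 1 ≤ j) (hjj : j ≤ j') (hj' : j' ≤ p - 1)
    (h1 : 1 ≤ iP b c j) (h2 : iP b c j < q) (h1' : 1 ≤ iP b c' j') (h2' : iP b c' j' < q) :
    False := by
  have hex : ∀ r, ∃ i, b i = beta m d p α r := fun r => by
    have : beta m d p α r ∈ Set.range b := by rw [hrange]; exact ⟨r, rfl⟩
    exact this
  choose idx hidx using hex
  have hsurj : ∀ i, ∃ r, idx r = i := fun i => by
    have : b i ∈ Set.range (beta m d p α) := by rw [← hrange]; exact ⟨i, rfl⟩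
    obtain ⟨r, hr⟩ := this
    exact ⟨r, hb.injective (by rw [hidx, hr])⟩
  have good := good_CC hb idx hidx
  obtain ⟨rl, hrl⟩ := hsurj ⟨q - 1, by omega⟩
  obtain ⟨r0, hr0⟩ := hsurj ⟨0, by omega⟩
  -- projection of Zc vanishes
  have hZ : ∀ k j, 1 ≤ j → j ≤ p - 1 → iP b k j < q → ∀ z ∈ Zc j, prj m d k z = 0 := by
    intro k j hj hj2 hlt z hz
    funext r
    have h := H _ (good (Equiv.swap r rl)) j hj hj2
    have hz' : z ∈ Vmap m b (CC (fun s => (idx (Equiv.swap r rl s) : ℕ))) j := by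
      rw [h]; exact Submodule.mem_sup_right hz
    have : prj m d k z ∈ CC (fun s => (idx (Equiv.swap r rl s) : ℕ)) (iP b k j) := by
      rw [← prj_Vmap m b (CC (fun s => (idx (Equiv.swap r rl s) : ℕ))) j k]; exact ⟨z, hz', rfl⟩
    rw [mem_CC] at this
    apply this
    simp [hrl]; omega
  have hA : ∀ k j, 1 ≤ j → j ≤ p - 1 → iP b k j < q → ∀ F, GoodChain m d p α b F →
      F (iP b k j) = (F (κ j)).map ((prj m d k).comp E) := by
    intro k j hj hj2 hlt F hF
    rw [← prj_Vmap m b F j k, H F hF j hj hj2, Submodule.map_sup, Submodule.map_comp]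
    apply sup_eq_left.2
    rintro _ ⟨z, hz, rfl⟩
    rw [hZ k j hj hj2 hlt z hz]; exact zero_mem _
  have hκ : ∀ k j, 1 ≤ j → j ≤ p - 1 → 1 ≤ iP b k j → iP b k j < q → κ j = iP b k j := by
    intro k j hj hj2 hge hlt
    by_contra hne
    obtain ⟨r, hr⟩ := hsurj ⟨iP b k j - 1, by omega⟩
    obtain ⟨s, hs⟩ := hsurj ⟨iP b k j, hlt⟩
    have e1 := hA k j hj hj2 hlt _ (good 1)
    have e2 := hA k j hj hj2 hlt _ (good (Equiv.swap r s))
    have e3 : CC (fun t => (idx ((1 : Equiv.Perm (Fin m)) t) : ℕ)) (κ j)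
        = CC (fun t => (idx (Equiv.swap r s t) : ℕ)) (κ j) := by
      have hiff : ∀ t, idx ((1 : Equiv.Perm (Fin m)) t) < κ j ↔ idx (Equiv.swap r s t) < κ j := by
        intro t
        rw [Equiv.Perm.one_apply]
        by_cases htr : t = r
        · subst htr; rw [Equiv.swap_apply_left, hr, hs]; simp only; omega
        · by_cases hts : t = s
          · subst hts; rw [Equiv.swap_apply_right, hr, hs]; simp only; omega
          · rw [Equiv.swap_apply_of_ne_of_ne htr hts]
      ext x
      rw [mem_CC, mem_CC]
      simp only [hiff]
    rw [e3, ← e2] at e1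
    have m1 : Pi.single r (1:ℂ) ∈ CC (fun t => (idx ((1 : Equiv.Perm (Fin m)) t) : ℕ)) (iP b k j) := by
      rw [single_mem_CC, Equiv.Perm.one_apply, hr]; simp only; omega
    rw [e1, single_mem_CC, Equiv.swap_apply_left, hs] at m1
    simp at m1
  have hc := hκ c j hj1 (by omega) h1 h2
  have hs2 : iP b c' j < q := lt_of_le_of_lt (iP_mono b c' hjj) h2'
  rcases Nat.eq_zero_or_pos (iP b c' j) with hs | hs
  · -- A_{c'} = 0
    have hA0 : (prj m d c').comp E = 0 := by
      apply LinearMap.pi_ext'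
      intro r
      apply LinearMap.ext_ring
      have hg := good (Equiv.swap r r0)
      have e := hA c' j hj1 (by omega) hs2 _ hg
      rw [hs, hg.1] at e
      have mem : Pi.single r (1:ℂ) ∈ CC (fun t => (idx (Equiv.swap r r0 t) : ℕ)) (κ j) := by
        rw [single_mem_CC, Equiv.swap_apply_left, hr0, hc]; simp only; omega
      have := Submodule.mem_map_of_mem (f := (prj m d c').comp E) mem
      rw [← e, Submodule.mem_bot] at this
      simpa using this
    have e := hA c' j' (by omega) hj' h2' _ (good 1)
    rw [hA0, Submodule.map_zero] at e
    have mem : Pi.single r0 (1:ℂ) ∈ CC (fun t => (idx ((1 : Equiv.Perm (Fin m)) t) : ℕ)) (iP b c' j') := by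
      rw [single_mem_CC, Equiv.Perm.one_apply, hr0]; simp only; omega
    rw [e, Submodule.mem_bot] at mem
    have := congrFun mem r0
    simp at this
  · have hc' := hκ c' j hj1 (by omega) hs hs2
    have hg := good 1
    set F := CC (fun t => (idx ((1 : Equiv.Perm (Fin m)) t) : ℕ)) with hF
    have e := hA c' j hj1 (by omega) hs2 _ hg
    rw [← hc'] at e
    have mem : Pi.single r0 (1:ℂ) ∈ F (iP b c j) := by
      rw [hF, single_mem_CC, Equiv.Perm.one_apply, hr0]; simp only; omega
    have memV : chi m d c (Pi.single r0 (1:ℂ)) ∈ Vmap m b F j :=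
      Submodule.mem_iSup_of_mem c (Submodule.mem_map_of_mem mem)
    rw [H F hg j hj1 (by omega), Submodule.mem_sup] at memV
    obtain ⟨_, ⟨v, hv, rfl⟩, z, hz, hvz⟩ := memV
    have hv' : (prj m d c') (E v) = 0 := by
      have := congrArg (prj m d c') hvz
      rw [map_add, hZ c' j hj1 (by omega) hs2 z hz, add_zero, prj_chi_ne _ _ _ _ hcc.symm] at this
      exact this
    have hv0 : v = 0 := by
      have hmaps : ∀ x ∈ F (κ j), ((prj m d c').comp E) x ∈ F (κ j) := by
        intro x hx
        rw [e]; exact Submodule.mem_map_of_mem hx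
      let g := ((prj m d c').comp E).restrict hmaps
      have gs : Function.Surjective g := by
        rintro ⟨y, hy⟩
        have hy2 := hy
        rw [e] at hy2
        obtain ⟨x, hx, hxy⟩ := hy2
        exact ⟨⟨x, hx⟩, Subtype.ext hxy⟩
      have gi : Function.Injective g := LinearMap.injective_iff_surjective.2 gs
      have : (⟨v, hv⟩ : F (κ j)) = 0 := by
        apply gi
        rw [map_zero]
        exact Subtype.ext hv'
      exact congrArg Subtype.val this
    have := congrArg (prj m d c) hvz
    rw [map_add, hZ c j hj1 (by omega) h2 z hz, add_zero, prj_chi_same, hv0, map_zero, map_zero] at this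
    have := congrFun this r0
    simp at this

theorem backward {m d p : ℕ} {q : ℕ} {α : Fin (d * m) → Fin p}
    (b : Fin q → Fin d → Fin p) (hq : 2 ≤ q) (c : Fin d)
    (h : ∀ k : Fin d, k ≠ c → ∀ i : Fin q, b i k = b ⟨q - 1, by omega⟩ k) :
    (∃ (V' Z : Submodule ℂ (Fin (d * m) → ℂ)) (ε : (Fin m → ℂ) ≃ₗ[ℂ] V')
        (Zc : ℕ → Submodule ℂ (Fin (d * m) → ℂ)) (κ : ℕ → ℕ),
        IsCompl V' Z ∧ (∀ j : ℕ, 1 ≤ j → j ≤ p - 1 → Zc j ≤ Z) ∧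
        (∀ j j' : ℕ, 1 ≤ j → j ≤ j' → j' ≤ p - 1 → Zc j ≤ Zc j') ∧
        (∀ j j' : ℕ, 1 ≤ j → j ≤ j' → j' ≤ p - 1 → κ j ≤ κ j') ∧
        (∀ j : ℕ, 1 ≤ j → j ≤ p - 1 → κ j ≤ q) ∧
        (∀ F : ℕ → Submodule ℂ (Fin m → ℂ), GoodChain m d p α b F →
          ∀ j : ℕ, 1 ≤ j → j ≤ p - 1 →
            Vmap m b F j =
              Submodule.map (V'.subtype.comp ε.toLinearMap) (F (κ j)) ⊔ Zc j)) := by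
  have hinj : Function.Injective (chi m d c) := fun x y hxy => by
    rw [← prj_chi_same m d c x, hxy, prj_chi_same]
  refine ⟨LinearMap.range (chi m d c), LinearMap.ker (prj m d c), LinearEquiv.ofInjective _ hinj,
    fun j => ⨆ (k : Fin d) (_ : k ≠ c), Submodule.map (chi m d k)
      (if (b ⟨q - 1, by omega⟩ k : ℕ) + 1 ≤ j then ⊤ else ⊥), fun j => iP b c j,
    ?_, ?_, ?_, ?_, ?_, ?_⟩
  · constructor
    · rw [Submodule.disjoint_def]
      rintro _ ⟨x, rfl⟩ hx
      rw [LinearMap.mem_ker, prj_chi_same] at hx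
      rw [hx, map_zero]
    · rw [codisjoint_iff, eq_top_iff]
      intro x _
      rw [Submodule.mem_sup]
      refine ⟨chi m d c (prj m d c x), ⟨_, rfl⟩, x - chi m d c (prj m d c x), ?_, by simp⟩
      rw [LinearMap.mem_ker, map_sub, prj_chi_same, sub_self]
  · intro j _ _
    refine iSup₂_le fun k hk => ?_
    rintro _ ⟨x, _, rfl⟩
    rw [LinearMap.mem_ker, prj_chi_ne _ _ _ _ hk.symm]
  · intro j j' _ hjj _
    refine iSup₂_mono fun k hk => Submodule.map_mono ?_
    split_ifs
    · exact le_rfl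
    · omega
    · exact bot_le
    · exact le_rfl
  · intro j j' _ hjj _
    exact iP_mono b c hjj
  · intro j _ _
    exact iP_le b c j
  · intro F hF j _ _
    rw [Vmap, iSup_split_single _ c]
    congr 1
    refine iSup_congr fun k => iSup_congr fun hk => ?_
    rw [iP_const (by omega) b k j _ (h k hk)]
    split_ifs
    · rw [hF.2.1]
    · rw [hF.1]

/-- Proposition 5.4(d), combinatorially. Assume `q ≥ 2`. The map
`φ : Fl(d_1,…,d_{q−1};ℂ^m) → Fl(t_1,…,t_{p−1};ℂ^n)`, `(F_i) ↦ (V_j)` with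
`V_j = χ_1(F_{i′_1(j)}) + ⋯ + χ_d(F_{i′_d(j)})`, is a strict standard extension — i.e.
there are a decomposition `ℂ^n = V′ ⊕ Z`, an isomorphism `ε : ℂ^m ≅ V′`, a nondecreasing
chain `Z_1 ⊆ ⋯ ⊆ Z_{p−1}` of subspaces of `Z` and a nondecreasing map
`κ : {1,…,p−1} → {0,1,…,q}` with `V_j = ε(F_{κ(j)}) + Z_j` for every chain and every
`j ∈ {1,…,p−1}` — if and only if there exists a colour `c ∈ {1,…,d}` such that
`(b_i)_k = (b_q)_k` for every `k ≠ c` and every `i ∈ {1,…,q}`. -/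
theorem stmt11 (m d p : ℕ) (hm : 0 < m) (hd : 0 < d) (hp : 0 < p)
    (α : Fin (d * m) → Fin p) (hα : Function.Surjective α)
    {q : ℕ} (b : Fin q → Fin d → Fin p) (hb : StrictMono b)
    (hrange : Set.range b = Set.range (beta m d p α)) (hq : 2 ≤ q) :
    (∃ (V' Z : Submodule ℂ (Fin (d * m) → ℂ)) (ε : (Fin m → ℂ) ≃ₗ[ℂ] V')
        (Zc : ℕ → Submodule ℂ (Fin (d * m) → ℂ)) (κ : ℕ → ℕ),
        IsCompl V' Z ∧ (∀ j : ℕ, 1 ≤ j → j ≤ p - 1 → Zc j ≤ Z) ∧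
        (∀ j j' : ℕ, 1 ≤ j → j ≤ j' → j' ≤ p - 1 → Zc j ≤ Zc j') ∧
        (∀ j j' : ℕ, 1 ≤ j → j ≤ j' → j' ≤ p - 1 → κ j ≤ κ j') ∧
        (∀ j : ℕ, 1 ≤ j → j ≤ p - 1 → κ j ≤ q) ∧
        (∀ F : ℕ → Submodule ℂ (Fin m → ℂ), GoodChain m d p α b F →
          ∀ j : ℕ, 1 ≤ j → j ≤ p - 1 →
            Vmap m b F j =
              Submodule.map (V'.subtype.comp ε.toLinearMap) (F (κ j)) ⊔ Zc j)) ↔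
      (∃ c : Fin d, ∀ k : Fin d, k ≠ c → ∀ i : Fin q, b i k = b ⟨q - 1, by omega⟩ k) := by
  constructor
  · rintro ⟨V', Z, ε, Zc, κ, -, -, -, -, -, H⟩
    by_contra! hcon
    obtain ⟨c, -, i, hi⟩ := hcon ⟨0, hd⟩
    obtain ⟨c', hcc, i', hi'⟩ := hcon c
    obtain ⟨j, hj1, hj2, h1, h2⟩ := exists_j hq b hb c i hi
    obtain ⟨j', hj1', hj2', h1', h2'⟩ := exists_j hq b hb c' i' hi'
    rcases le_total j j' with hjj | hjj
    · exact key hb hrange hq _ Zc κ H c c' hcc.symm j j' hj1 hjj hj2' h1 h2 h1' h2'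
    · exact key hb hrange hq _ Zc κ H c' c hcc j' j hj1' hjj hj2 h1' h2' h1 h2
  · rintro ⟨c, h⟩
    exact backward b hq c h
end
end
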